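/- There exists a universal constant ᾱ₀ ≥ 1 such that for every ᾱ ≥ ᾱ₀ and all smooth mean-zero 2π-periodic functions u, w : ℝ → ℝ, one has (1/2)·( ‖Dw‖_{L²}² + ᾱ ( ‖w‖_{L²}^{10/3} + (1 + ‖u‖_{L²}²) ‖w‖_{L²}² ) ) ≤ ∫₀^{2π} ( (Dw(x))² − w(x)³/3 − u(x) w(x)² ) dx + ᾱ ( ‖w‖_{L²}^{10/3} + (1 + ‖u‖_{L²}²) ‖w‖_{L²}² ) ≤ (3/2)·( ‖Dw‖_{L²}² + ᾱ ( ‖w‖_{L²}^{10/3} + (1 + ‖u‖_{L²}²) ‖w‖_{L²}² ) ). -/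

import Mathlib

open MeasureTheory Real Filter

noncomputable section

/-- A smooth, mean-zero, `2π`-periodic function `v : ℝ → ℝ`. -/
def SmoothMeanZeroPeriodic (v : ℝ → ℝ) : Prop :=
  ContDiff ℝ (⊤ : ℕ∞) v ∧ (∀ x : ℝ, v (x + 2 * Real.pi) = v x) ∧
    (∫ x in (0:ℝ)..(2 * Real.pi), v x) = 0

/-- The `L²` norm over one period: `(∫₀^{2π} |v|²)^{1/2}`. -/
def L2norm (v : ℝ → ℝ) : ℝ := Real.sqrt (∫ x in (0:ℝ)..(2 * Real.pi), (v x) ^ 2)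

theorem L2norm_nonneg (v : ℝ → ℝ) : 0 ≤ L2norm v := Real.sqrt_nonneg _

theorem L2norm_sq (v : ℝ → ℝ) : L2norm v ^ 2 = ∫ x in (0:ℝ)..(2 * Real.pi), (v x) ^ 2 :=
  Real.sq_sqrt (intervalIntegral.integral_nonneg Real.two_pi_pos.le fun _ _ => sq_nonneg _)

/-- Cauchy–Schwarz for continuous functions over one period. -/
theorem integral_abs_mul_le_L2norm_mul {f g : ℝ → ℝ} (hf : Continuous f) (hg : Continuous g) :
    ∫ x in (0:ℝ)..(2 * Real.pi), |f x| * |g x| ≤ L2norm f * L2norm g := by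
  have hq : ∀ t : ℝ, 0 ≤ L2norm f ^ 2 * (t * t)
      + (2 * ∫ x in (0:ℝ)..(2 * Real.pi), |f x| * |g x|) * t + L2norm g ^ 2 := by
    intro t
    have h : (∫ x in (0:ℝ)..(2 * Real.pi), (t * |f x| + |g x|) ^ 2)
        = L2norm f ^ 2 * (t * t)
          + (2 * ∫ x in (0:ℝ)..(2 * Real.pi), |f x| * |g x|) * t + L2norm g ^ 2 := by
      have hexp : ∀ x, (t * |f x| + |g x|) ^ 2
          = (t * t) * f x ^ 2 + (2 * t) * (|f x| * |g x|) + g x ^ 2 := by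
        intro x
        rw [← sq_abs (f x), ← sq_abs (g x)]
        ring
      simp_rw [hexp]
      rw [intervalIntegral.integral_add (Continuous.intervalIntegrable (by fun_prop) _ _)
          (Continuous.intervalIntegrable (by fun_prop) _ _),
        intervalIntegral.integral_add (Continuous.intervalIntegrable (by fun_prop) _ _)
          (Continuous.intervalIntegrable (by fun_prop) _ _),
        intervalIntegral.integral_const_mul, intervalIntegral.integral_const_mul,
        L2norm_sq, L2norm_sq]
      ring
    rw [← h]
    exact intervalIntegral.integral_nonneg Real.two_pi_pos.le fun _ _ => sq_nonneg _
  have hd := discrim_le_zero hq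
  rw [discrim] at hd
  refine le_of_sq_le_sq ?_ (mul_nonneg (L2norm_nonneg f) (L2norm_nonneg g))
  nlinarith

theorem exists_zero_of_integral_eq_zero {w : ℝ → ℝ} (hw : Continuous w) {a b : ℝ} (hab : a < b)
    (h : ∫ x in a..b, w x = 0) : ∃ c ∈ Set.Ioo a b, w c = 0 := by
  have hd : ∀ x, HasDerivAt (fun y => ∫ t in a..y, w t) (w x) x := fun x =>
    intervalIntegral.integral_hasDerivAt_right (hw.intervalIntegrable _ _)
      (hw.stronglyMeasurableAtFilter _ _) hw.continuousAt
  exact exists_hasDerivAt_eq_zero hab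
    (fun x _ => (hd x).continuousAt.continuousWithinAt) (by simp [h]) fun x _ => hd x

/-- Agmon's inequality for mean-zero functions on one period. -/
theorem sq_le_two_mul_L2norm_mul_L2norm_deriv {w : ℝ → ℝ} (hw : ContDiff ℝ 1 w)
    (h0 : ∫ x in (0:ℝ)..(2 * Real.pi), w x = 0) {x : ℝ} (hx : x ∈ Set.Icc 0 (2 * Real.pi)) :
    w x ^ 2 ≤ 2 * (L2norm w * L2norm (deriv w)) := by
  have hc : Continuous w := hw.continuous
  have hc' : Continuous (deriv w) := hw.continuous_deriv le_rfl
  obtain ⟨c, hcI, hwc⟩ := exists_zero_of_integral_eq_zero hc Real.two_pi_pos h0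
  have hd : ∀ y, HasDerivAt (fun y => w y ^ 2) (2 * (w y * deriv w y)) y := by
    intro y
    simpa [mul_assoc] using ((hw.differentiable one_ne_zero y).hasDerivAt).fun_pow 2
  have hftc : ∫ y in c..x, 2 * (w y * deriv w y) = w x ^ 2 := by
    rw [intervalIntegral.integral_eq_sub_of_hasDerivAt (fun y _ => hd y)
      (Continuous.intervalIntegrable (by fun_prop) _ _), hwc]
    ring
  have hnn : 0 ≤ ∫ y in (0:ℝ)..(2 * Real.pi), |w y| * |deriv w y| :=
    intervalIntegral.integral_nonneg Real.two_pi_pos.le fun _ _ => by positivity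
  have hsub : Set.uIoc c x ⊆ Set.uIoc 0 (2 * Real.pi) := by
    rw [Set.uIoc_of_le Real.two_pi_pos.le]
    exact Set.Ioc_subset_Ioc (le_min hcI.1.le hx.1) (max_le hcI.2.le hx.2)
  calc w x ^ 2 = ∫ y in c..x, 2 * (w y * deriv w y) := hftc.symm
    _ = 2 * ∫ y in c..x, w y * deriv w y := intervalIntegral.integral_const_mul _ _
    _ ≤ 2 * |∫ y in c..x, (|w y| * |deriv w y|)| := by
        gcongr
        refine (le_abs_self _).trans ?_
        simpa only [Real.norm_eq_abs, abs_mul] using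
          intervalIntegral.norm_integral_le_abs_integral_norm
            (f := fun y => w y * deriv w y) (a := c) (b := x) (μ := volume)
    _ ≤ 2 * |∫ y in (0:ℝ)..(2 * Real.pi), (|w y| * |deriv w y|)| := by
        gcongr 2 * ?_
        exact intervalIntegral.abs_integral_mono_interval hsub
          (Eventually.of_forall fun y => by positivity)
          (Continuous.intervalIntegrable (by fun_prop) _ _)
    _ ≤ 2 * (L2norm w * L2norm (deriv w)) := by
        rw [abs_of_nonneg hnn]
        gcongr
        exact integral_abs_mul_le_L2norm_mul hc hc'

theorem abs_integral_cubic_add_le {u w : ℝ → ℝ} {M : ℝ} (hu : Continuous u) (hw : Continuous w)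
    (hM : ∀ x ∈ Set.Icc 0 (2 * Real.pi), |w x| ≤ M) :
    |∫ x in (0:ℝ)..(2 * Real.pi), ((w x) ^ 3 / 3 + u x * (w x) ^ 2)|
      ≤ M * L2norm w ^ 2 / 3 + M * (L2norm u * L2norm w) := by
  have hM0 : 0 ≤ M := (abs_nonneg _).trans (hM 0 ⟨le_rfl, Real.two_pi_pos.le⟩)
  calc |∫ x in (0:ℝ)..(2 * Real.pi), ((w x) ^ 3 / 3 + u x * (w x) ^ 2)|
      ≤ ∫ x in (0:ℝ)..(2 * Real.pi), |(w x) ^ 3 / 3 + u x * (w x) ^ 2| :=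
        intervalIntegral.abs_integral_le_integral_abs Real.two_pi_pos.le
    _ ≤ ∫ x in (0:ℝ)..(2 * Real.pi), (M / 3 * (w x) ^ 2 + M * (|u x| * |w x|)) := by
        refine intervalIntegral.integral_mono_on Real.two_pi_pos.le
          (Continuous.intervalIntegrable (by fun_prop) _ _)
          (Continuous.intervalIntegrable (by fun_prop) _ _) fun x hx => ?_
        have h := hM x hx
        calc |(w x) ^ 3 / 3 + u x * (w x) ^ 2|
            ≤ |(w x) ^ 3 / 3| + |u x * (w x) ^ 2| := abs_add_le _ _
          _ = |w x| * |w x| ^ 2 / 3 + |w x| * (|u x| * |w x|) := by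
              rw [abs_div, abs_mul, abs_pow, abs_pow, abs_of_pos (three_pos : (0:ℝ) < 3)]
              ring
          _ ≤ M * |w x| ^ 2 / 3 + M * (|u x| * |w x|) := by gcongr
          _ = M / 3 * (w x) ^ 2 + M * (|u x| * |w x|) := by rw [sq_abs]; ring
    _ = M * L2norm w ^ 2 / 3 + M * ∫ x in (0:ℝ)..(2 * Real.pi), |u x| * |w x| := by
        rw [intervalIntegral.integral_add (Continuous.intervalIntegrable (by fun_prop) _ _)
            (Continuous.intervalIntegrable (by fun_prop) _ _),
          intervalIntegral.integral_const_mul, intervalIntegral.integral_const_mul, L2norm_sq]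
        ring
    _ ≤ M * L2norm w ^ 2 / 3 + M * (L2norm u * L2norm w) := by
        gcongr
        exact integral_abs_mul_le_L2norm_mul hu hw

/-- The Young inequalities absorbing the cubic terms, given `M ^ 2 ≤ 2 * A * B`. -/
theorem cubic_absorption {A B U M : ℝ} (hA : 0 ≤ A) (hM : M ^ 2 ≤ 2 * (A * B)) :
    M * A ^ 2 / 3 + M * (U * A)
      ≤ 1 / 2 * B ^ 2 + 2 * (A ^ ((10:ℝ) / 3) + (1 + U ^ 2) * A ^ 2) := by
  obtain ⟨a, ha, rfl⟩ : ∃ a : ℝ, 0 ≤ a ∧ a ^ 3 = A :=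
    ⟨A ^ ((1:ℝ) / 3), by positivity, by rw [← Real.rpow_mul_natCast hA]; norm_num⟩
  have hpow : (a ^ 3) ^ ((10:ℝ) / 3) = a ^ 10 := by
    rw [← Real.rpow_natCast_mul ha, ← Real.rpow_natCast]
    norm_num
  rw [hpow]
  have h₁ : M * (a ^ 3) ^ 2 ≤ (M ^ 2 * a ^ 2 + a ^ 10) / 2 := by
    nlinarith [sq_nonneg (M * a - a ^ 5)]
  have h₂ : M ^ 2 * a ^ 2 ≤ 2 * (a ^ 3 * B) * a ^ 2 := by gcongr
  have h₃ : 2 * (a ^ 3 * B) * a ^ 2 ≤ B ^ 2 + a ^ 10 := by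
    nlinarith [sq_nonneg (B - a ^ 5)]
  have h₄ : M * (U * a ^ 3) ≤ M ^ 2 / 8 + 2 * (U * a ^ 3) ^ 2 := by
    nlinarith [sq_nonneg (M - 4 * (U * a ^ 3))]
  have h₅ : 2 * (a ^ 3 * B) ≤ B ^ 2 + (a ^ 3) ^ 2 := by
    nlinarith [sq_nonneg (B - a ^ 3)]
  have h₆ : 0 ≤ a ^ 10 := by positivity
  nlinarith [sq_nonneg B, sq_nonneg (a ^ 3)]

/-- equivalence of the positivized modified Hamiltonian `𝓘̃₁⁺(w,u)`
with `‖Dw‖² + ᾱ(‖w‖^{10/3} + (1+‖u‖²)‖w‖²)`. -/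
theorem modified_FP_hamiltonian_equivalence :
    ∃ α₀ : ℝ, 1 ≤ α₀ ∧
      ∀ α : ℝ, α₀ ≤ α →
        ∀ u w : ℝ → ℝ, SmoothMeanZeroPeriodic u → SmoothMeanZeroPeriodic w →
          (1 / 2) * ((L2norm (deriv w)) ^ 2
              + α * ((L2norm w) ^ ((10:ℝ)/3) + (1 + (L2norm u) ^ 2) * (L2norm w) ^ 2))
            ≤ (∫ x in (0:ℝ)..(2 * Real.pi),
                  ((deriv w x) ^ 2 - (w x) ^ 3 / 3 - u x * (w x) ^ 2))
                + α * ((L2norm w) ^ ((10:ℝ)/3) + (1 + (L2norm u) ^ 2) * (L2norm w) ^ 2) ∧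
          (∫ x in (0:ℝ)..(2 * Real.pi),
                  ((deriv w x) ^ 2 - (w x) ^ 3 / 3 - u x * (w x) ^ 2))
                + α * ((L2norm w) ^ ((10:ℝ)/3) + (1 + (L2norm u) ^ 2) * (L2norm w) ^ 2)
            ≤ (3 / 2) * ((L2norm (deriv w)) ^ 2
                + α * ((L2norm w) ^ ((10:ℝ)/3) + (1 + (L2norm u) ^ 2) * (L2norm w) ^ 2)) := by
  refine ⟨4, by norm_num, fun α hα u w ⟨hu, _, _⟩ ⟨hw, _, hw0⟩ => ?_⟩
  have hw1 : ContDiff ℝ 1 w := hw.of_le (by exact_mod_cast le_top)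
  have hwc : Continuous w := hw.continuous
  have huc : Continuous u := hu.continuous
  have hwc' : Continuous (deriv w) := hw1.continuous_deriv le_rfl
  have hsplit : (∫ x in (0:ℝ)..(2 * Real.pi),
      ((deriv w x) ^ 2 - (w x) ^ 3 / 3 - u x * (w x) ^ 2))
      = L2norm (deriv w) ^ 2
        - ∫ x in (0:ℝ)..(2 * Real.pi), ((w x) ^ 3 / 3 + u x * (w x) ^ 2) := by
    simp_rw [sub_sub]
    rw [intervalIntegral.integral_sub (Continuous.intervalIntegrable (by fun_prop) _ _)
      (Continuous.intervalIntegrable (by fun_prop) _ _), L2norm_sq]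
  have hA : 0 ≤ L2norm w := L2norm_nonneg w
  have hB : 0 ≤ L2norm (deriv w) := L2norm_nonneg _
  have hcubic := (abs_integral_cubic_add_le huc hwc fun x hx =>
    Real.abs_le_sqrt (sq_le_two_mul_L2norm_mul_L2norm_deriv hw1 hw0 hx)).trans
    (cubic_absorption (U := L2norm u) hA (Real.sq_sqrt (by positivity)).le)
  have hP : 0 ≤ L2norm w ^ ((10:ℝ) / 3) + (1 + L2norm u ^ 2) * L2norm w ^ 2 := by positivity
  have hαP := mul_le_mul_of_nonneg_right hα hP
  obtain ⟨hlo, hhi⟩ := abs_le.mp hcubic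
  rw [hsplit]
  constructor <;> linarith
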